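/- Let p and q be two distinct prime numbers. Then there is no Hopf algebra H over k of dimension pq such that the group G(H) of group-like elements of H has order p and the group G(H*) of group-like elements of the dual Hopf algebra H* (equivalently, the set of k-algebra homomorphisms H → k under convolution) has order q. -/

import Mathlib

open scoped TensorProduct

/-- A group-like element of a coalgebra: a nonzero element `a` with `Δ a = a ⊗ a`. -/
def IsGroupLike (k : Type*) {H : Type*} [CommSemiring k] [AddCommMonoid H] [Module k H]
    [Coalgebra k H] (a : H) : Prop :=
  a ≠ 0 ∧ Coalgebra.comul (R := k) a = a ⊗ₜ[k] a

/-- The convolution product on the dual of a coalgebra. -/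
noncomputable def conv {k H : Type*} [CommSemiring k] [AddCommMonoid H] [Module k H]
    [Coalgebra k H] (f g : Module.Dual k H) : Module.Dual k H :=
  LinearMap.mul' k k ∘ₗ TensorProduct.map f g ∘ₗ Coalgebra.comul

/-- `l ∈ H*` is a right integral of `H*`: `l * β = β(1) • l` for the convolution product. -/
def IsRightIntegralDual (k : Type*) {H : Type*} [CommSemiring k] [Semiring H]
    [HopfAlgebra k H] (l : Module.Dual k H) : Prop :=
  ∀ f : Module.Dual k H, conv l f = f 1 • l

/-- `Λ ∈ H` is a left integral of `H`: `a * Λ = ε(a) • Λ` for all `a`. -/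
def IsLeftIntegral (k : Type*) {H : Type*} [CommSemiring k] [Semiring H]
    [HopfAlgebra k H] (L : H) : Prop :=
  ∀ a : H, a * L = Coalgebra.counit (R := k) a • L

/-- `Λ ∈ H` is a right integral of `H`: `Λ * a = ε(a) • Λ` for all `a`. -/
def IsRightIntegral (k : Type*) {H : Type*} [CommSemiring k] [Semiring H]
    [HopfAlgebra k H] (L : H) : Prop :=
  ∀ a : H, L * a = Coalgebra.counit (R := k) a • L

/-- `g` is the distinguished group-like element of `H`: it is group-like and
`β * λ = β(g) • λ` for some nonzero right integral `λ` of `H*`. -/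
def IsDistinguishedGroupLike (k : Type*) {H : Type*} [CommSemiring k] [Semiring H]
    [HopfAlgebra k H] (g : H) : Prop :=
  IsGroupLike k g ∧ ∃ l : Module.Dual k H, l ≠ 0 ∧ IsRightIntegralDual k l ∧
    ∀ f : Module.Dual k H, conv f l = f g • l

/-- `α` is the distinguished group-like element of `H*`: an algebra map `H → k` with
`Λ * a = α(a) • Λ` for some nonzero left integral `Λ` of `H`. -/
def IsDistinguishedGroupLikeDual (k : Type*) {H : Type*} [CommSemiring k] [Semiring H]
    [HopfAlgebra k H] (α : H →ₐ[k] k) : Prop :=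
  ∃ L : H, L ≠ 0 ∧ IsLeftIntegral k L ∧ ∀ a : H, L * a = α a • L

/-- `IsHopfIndex k g n` : `n` is the index of the Hopf algebra `H` with distinguished
group-like element `g`, i.e. the smallest positive integer `n` with `S ^ (4 n) = id` and
`g ^ n = 1`, where `S` is the antipode. -/
def IsHopfIndex (k : Type*) {H : Type*} [CommSemiring k] [Semiring H] [HopfAlgebra k H]
    (g : H) (n : ℕ) : Prop :=
  0 < n ∧ (HopfAlgebra.antipode (R := k) (A := H) : Module.End k H) ^ (4 * n) = 1 ∧ g ^ n = 1 ∧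
    ∀ m : ℕ, 0 < m → (HopfAlgebra.antipode (R := k) (A := H) : Module.End k H) ^ (4 * m) = 1 →
      g ^ m = 1 → n ≤ m

/-- The simultaneous eigenspace `H^ω_{a,i,j} = {u ∈ H | S² u = (-1)^a ω^i • u, u * g = ω^j • u}`
for `(a,i,j) ∈ ℤ/2 × ℤ/n × ℤ/n`. -/
noncomputable def hopfEigenspace {k H : Type*} [CommRing k] [Ring H] [HopfAlgebra k H]
    (g : H) (ω : k) {n : ℕ} (t : ZMod 2 × ZMod n × ZMod n) : Submodule k H :=
  Module.End.eigenspace ((HopfAlgebra.antipode (R := k) (A := H) : Module.End k H) ^ 2)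
      ((-1 : k) ^ t.1.val * ω ^ t.2.1.val) ⊓
    Module.End.eigenspace (LinearMap.mulRight k g : Module.End k H) (ω ^ t.2.2.val)

/-- Convolution powers of an element of the dual; the zeroth power is the counit,
the unit of the convolution algebra. -/
noncomputable def convPow {k H : Type*} [CommSemiring k] [AddCommMonoid H] [Module k H]
    [Coalgebra k H] (f : Module.Dual k H) : ℕ → Module.Dual k H
  | 0 => Coalgebra.counit
  | m + 1 => conv f (convPow f m)

open Coalgebra WithConv

/-- The dual of a Hopf algebra `H` over `k`, with the convolution product. -/
def HopfDual (k H : Type*) [Field k] [Ring H] [HopfAlgebra k H] : Type _ :=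
  WithConv (H →ₗ[k] k)

namespace HopfDual

section Algebra

variable {k H : Type*} [Field k] [Ring H] [HopfAlgebra k H]

noncomputable instance : Ring (HopfDual k H) := inferInstanceAs (Ring (WithConv (H →ₗ[k] k)))

noncomputable instance : Algebra k (HopfDual k H) :=
  inferInstanceAs (Algebra k (WithConv (H →ₗ[k] k)))

instance : FunLike (HopfDual k H) H k where
  coe f := f.ofConv
  coe_injective _ _ h := WithConv.ofConv_injective (DFunLike.coe_injective h)

instance : LinearMapClass (HopfDual k H) k H k where
  map_add f := f.ofConv.map_add
  map_smulₛₗ f := f.ofConv.map_smul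

@[ext]
lemma ext {f g : HopfDual k H} (h : ∀ a, f a = g a) : f = g := DFunLike.ext _ _ h

variable (k H) in
/-- The identification of `HopfDual k H` with the linear dual of `H`. -/
noncomputable def toDual : HopfDual k H ≃ₗ[k] Module.Dual k H where
  toFun f := f.ofConv
  invFun f := WithConv.toConv f
  map_add' _ _ := rfl
  map_smul' _ _ := rfl
  left_inv _ := rfl
  right_inv _ := rfl

@[simp] lemma toDual_apply (f : HopfDual k H) (a : H) : toDual k H f a = f a := rfl

@[simp] lemma toDual_symm_apply (f : Module.Dual k H) (a : H) : (toDual k H).symm f a = f a := rfl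

@[simp] lemma smul_apply (c : k) (f : HopfDual k H) (a : H) : (c • f) a = c * f a := rfl

@[simp] lemma sum_apply {ι : Type*} (s : Finset ι) (f : ι → HopfDual k H) (a : H) :
    (∑ i ∈ s, f i) a = ∑ i ∈ s, f i a := by
  simp [← toDual_apply]

@[simp] lemma one_apply (a : H) : (1 : HopfDual k H) a = counit (R := k) a := rfl

lemma algebraMap_apply (c : k) (a : H) :
    algebraMap k (HopfDual k H) c a = c * counit (R := k) a := rfl

lemma mul_apply {ι : Type*} {a : H} (r : Coalgebra.Repr k a ι) (f g : HopfDual k H) :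
    (f * g) a = ∑ i ∈ r.index, f (r.left i) * g (r.right i) :=
  r.convMul_apply f g

lemma mul_apply_eq (f g : HopfDual k H) (a : H) :
    (f * g) a = LinearMap.mul' k k (TensorProduct.map (toDual k H f) (toDual k H g) (comul a)) :=
  rfl

lemma mul_apply_of_comul_eq {a : H} (ha : comul (R := k) a = a ⊗ₜ a) (f g : HopfDual k H) :
    (f * g) a = f a * g a := by
  simp [mul_apply_eq, ha]

end Algebra

section Bialgebra

variable (k H : Type*) [Field k] [Ring H] [HopfAlgebra k H] [FiniteDimensional k H]

instance : FiniteDimensional k (HopfDual k H) := (toDual k H).symm.finiteDimensional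

/-- The pairing of `H* ⊗ H*` with `H ⊗ H`, as a linear equivalence. -/
noncomputable def pairing :
    HopfDual k H ⊗[k] HopfDual k H ≃ₗ[k] Module.Dual k (H ⊗[k] H) :=
  TensorProduct.congr (toDual k H) (toDual k H) ≪≫ₗ
    TensorProduct.dualDistribEquiv k H H

/-- The pairing of `H* ⊗ (H* ⊗ H*)` with `H ⊗ (H ⊗ H)`, as a linear equivalence. -/
noncomputable def triplePairing :
    HopfDual k H ⊗[k] (HopfDual k H ⊗[k] HopfDual k H) ≃ₗ[k]
      Module.Dual k (H ⊗[k] (H ⊗[k] H)) :=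
  TensorProduct.congr (toDual k H) (pairing k H) ≪≫ₗ
    TensorProduct.dualDistribEquiv k H (H ⊗[k] H)

variable {k H}

@[simp]
lemma pairing_tmul (f g : HopfDual k H) (a b : H) :
    pairing k H (f ⊗ₜ g) (a ⊗ₜ b) = f a * g b := rfl

@[simp]
lemma triplePairing_tmul (f : HopfDual k H)
    (x : HopfDual k H ⊗[k] HopfDual k H) (a : H) (t : H ⊗[k] H) :
    triplePairing k H (f ⊗ₜ x) (a ⊗ₜ t) = f a * pairing k H x t := rfl

lemma triplePairing_assoc_tmul (f : HopfDual k H)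
    (x : HopfDual k H ⊗[k] HopfDual k H) (a b c : H) :
    triplePairing k H (TensorProduct.assoc k _ _ _ (x ⊗ₜ f)) (a ⊗ₜ (b ⊗ₜ c)) =
      pairing k H x (a ⊗ₜ b) * f c := by
  induction x with
  | zero => simp
  | tmul g h => simp [mul_assoc]
  | add x y hx hy => simp [TensorProduct.add_tmul, hx, hy, add_mul]

lemma pairing_ext {x y : HopfDual k H ⊗[k] HopfDual k H}
    (h : ∀ a b : H, pairing k H x (a ⊗ₜ b) = pairing k H y (a ⊗ₜ b)) : x = y :=
  (pairing k H).injective (TensorProduct.ext' h)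

lemma triplePairing_ext
    {x y : HopfDual k H ⊗[k] (HopfDual k H ⊗[k] HopfDual k H)}
    (h : ∀ a b c : H, triplePairing k H x (a ⊗ₜ (b ⊗ₜ c)) =
      triplePairing k H y (a ⊗ₜ (b ⊗ₜ c))) : x = y :=
  (triplePairing k H).injective (TensorProduct.ext_threefold' h)

/-- The comultiplication of `H*` is the transpose of the multiplication of `H`, and its counit is
evaluation at `1`. -/
noncomputable instance : CoalgebraStruct k (HopfDual k H) where
  comul := (pairing k H).symm.toLinearMap ∘ₗ (LinearMap.mul' k H).dualMap ∘ₗ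
    (toDual k H).toLinearMap
  counit := LinearMap.applyₗ (1 : H) ∘ₗ (toDual k H).toLinearMap

lemma counit_apply (f : HopfDual k H) : counit (R := k) f = f 1 := rfl

@[simp]
lemma pairing_comul (f : HopfDual k H) (a b : H) :
    pairing k H (comul f) (a ⊗ₜ b) = f (a * b) := by
  change pairing k H ((pairing k H).symm _) (a ⊗ₜ b) = _
  rw [LinearEquiv.apply_symm_apply]
  rfl

lemma sum_repr {ι : Type*} {f : HopfDual k H} (r : Coalgebra.Repr k f ι) (a b : H) :
    ∑ i ∈ r.index, r.left i a * r.right i b = f (a * b) := by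
  rw [← pairing_comul, ← r.eq]
  simp

noncomputable instance : Coalgebra k (HopfDual k H) where
  coassoc := by
    ext f : 1
    refine triplePairing_ext fun a b c ↦ ?_
    have r := ℛ k f
    simp only [LinearMap.comp_apply, LinearEquiv.coe_coe, ← r.eq, map_sum,
      LinearMap.rTensor_tmul, LinearMap.lTensor_tmul, LinearMap.sum_apply,
      triplePairing_assoc_tmul, triplePairing_tmul, pairing_comul, sum_repr, mul_assoc]
  rTensor_counit_comp_comul := by
    ext f : 1
    apply (TensorProduct.lid k _).injective
    have r := ℛ k f
    simp only [LinearMap.comp_apply, ← r.eq, map_sum, LinearMap.rTensor_tmul,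
      TensorProduct.lid_tmul, TensorProduct.mk_apply, one_smul]
    ext a
    simpa [counit_apply] using sum_repr r 1 a
  lTensor_counit_comp_comul := by
    ext f : 1
    apply (TensorProduct.rid k _).injective
    have r := ℛ k f
    simp only [LinearMap.comp_apply, ← r.eq, map_sum, LinearMap.lTensor_tmul,
      TensorProduct.rid_tmul, TensorProduct.mk_apply, LinearMap.flip_apply, one_smul]
    ext a
    simpa [counit_apply, mul_comm] using sum_repr r a 1

lemma pairing_mul {ι κ : Type*} (x y : HopfDual k H ⊗[k] HopfDual k H) {a b : H}
    (r : Coalgebra.Repr k a ι) (s : Coalgebra.Repr k b κ) :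
    pairing k H (x * y) (a ⊗ₜ b) =
      ∑ i ∈ r.index, ∑ j ∈ s.index, pairing k H x (r.left i ⊗ₜ s.left j) *
        pairing k H y (r.right i ⊗ₜ s.right j) := by
  induction x with
  | zero => simp
  | add x x' hx hx' => simp [add_mul, hx, hx', Finset.sum_add_distrib]
  | tmul f g =>
    induction y with
    | zero => simp
    | add y y' hy hy' => simp [mul_add, hy, hy', Finset.sum_add_distrib]
    | tmul f' g' =>
      simp only [Algebra.TensorProduct.tmul_mul_tmul, pairing_tmul, mul_apply r,
        mul_apply s, Finset.sum_mul_sum]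
      exact Finset.sum_congr rfl fun i _ ↦ Finset.sum_congr rfl fun j _ ↦ mul_mul_mul_comm ..

lemma comul_mul (f g : HopfDual k H) :
    comul (R := k) (f * g) = comul f * comul g := by
  refine pairing_ext fun a b ↦ ?_
  rw [pairing_comul, mul_apply ((ℛ k a).mul (ℛ k b)), pairing_mul _ _ (ℛ k a) (ℛ k b)]
  simp [Finset.sum_product]

noncomputable instance : Bialgebra k (HopfDual k H) :=
  Bialgebra.mk' k _ (by simp [counit_apply])
    (fun {f g} ↦ by simp [counit_apply, mul_apply_of_comul_eq, Algebra.TensorProduct.one_def])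
    (pairing_ext fun a b ↦ by simp [Algebra.TensorProduct.one_def])
    (fun {f g} ↦ comul_mul f g)

noncomputable instance : HopfAlgebra k (HopfDual k H) where
  antipode := (toDual k H).symm.toLinearMap ∘ₗ
    (HopfAlgebra.antipode k (A := H)).dualMap ∘ₗ (toDual k H).toLinearMap
  mul_antipode_rTensor_comul := by
    ext f a
    have r := ℛ k f
    have s := ℛ k a
    simp only [LinearMap.comp_apply, ← r.eq, map_sum, LinearMap.rTensor_tmul,
      LinearMap.mul'_apply, sum_apply, mul_apply s]
    rw [Finset.sum_comm]
    simp only [LinearEquiv.coe_coe, toDual_symm_apply, toDual_apply,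
      LinearMap.dualMap_apply, sum_repr]
    rw [← map_sum, HopfAlgebra.sum_antipode_mul_eq_smul s]
    simp [counit_apply, algebraMap_apply, mul_comm]
  mul_antipode_lTensor_comul := by
    ext f a
    have r := ℛ k f
    have s := ℛ k a
    simp only [LinearMap.comp_apply, ← r.eq, map_sum, LinearMap.lTensor_tmul,
      LinearMap.mul'_apply, sum_apply, mul_apply s]
    rw [Finset.sum_comm]
    simp only [LinearEquiv.coe_coe, toDual_symm_apply, toDual_apply,
      LinearMap.dualMap_apply, sum_repr]
    rw [← map_sum, HopfAlgebra.sum_mul_antipode_eq_smul s]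
    simp [counit_apply, algebraMap_apply, mul_comm]

end Bialgebra
end HopfDual

section EigenProj

variable {k V : Type*} [Field k] [AddCommGroup V] [Module k V]

/-- For `F` with `F ^ r = 1` and `μ ^ r = 1`, the projection onto the `μ`-eigenspace of `F`. -/
noncomputable def eigenProj (F : Module.End k V) (r : ℕ) (μ : k) : Module.End k V :=
  (r : k)⁻¹ • ∑ b ∈ Finset.range r, (μ⁻¹ • F) ^ b

variable {F : Module.End k V} {r : ℕ} {μ : k}

lemma ne_zero_of_pow_eq_one' (hr : r ≠ 0) (hμ : μ ^ r = 1) : μ ≠ 0 := by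
  rintro rfl
  simp [hr] at hμ

lemma mul_eigenProj (hr : r ≠ 0) (hF : F ^ r = 1) (hμ : μ ^ r = 1) :
    F * eigenProj F r μ = μ • eigenProj F r μ := by
  have hμ0 := ne_zero_of_pow_eq_one' hr hμ
  have h : (μ⁻¹ • F) * ∑ b ∈ Finset.range r, (μ⁻¹ • F) ^ b =
      ∑ b ∈ Finset.range r, (μ⁻¹ • F) ^ b := by
    rw [← sub_eq_zero, ← sub_one_mul, mul_geom_sum, smul_pow, hF, inv_pow, hμ]
    simp
  rw [eigenProj, mul_smul_comm, smul_comm μ]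
  congr 1
  conv_rhs => rw [← h, smul_mul_assoc, smul_smul, mul_inv_cancel₀ hμ0, one_smul]

lemma apply_eigenProj (hr : r ≠ 0) (hF : F ^ r = 1) (hμ : μ ^ r = 1) (v : V) :
    F (eigenProj F r μ v) = μ • eigenProj F r μ v :=
  congr($(mul_eigenProj hr hF hμ) v)

lemma eigenProj_apply_of_eq [CharZero k] (hr : r ≠ 0) (hμ : μ ^ r = 1) {v : V}
    (hv : F v = μ • v) : eigenProj F r μ v = v := by
  have hμ0 := ne_zero_of_pow_eq_one' hr hμ
  have h : ∀ b : ℕ, ((μ⁻¹ • F) ^ b) v = v := fun b ↦ by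
    induction b with
    | zero => simp
    | succ b ih => rw [pow_succ', Module.End.mul_apply, ih]; simp [hv, hμ0]
  simp only [eigenProj, LinearMap.smul_apply, LinearMap.sum_apply, h, Finset.sum_const,
    Finset.card_range, ← Nat.cast_smul_eq_nsmul k]
  rw [smul_smul, inv_mul_cancel₀ (by simpa using hr), one_smul]

lemma sum_eigenProj [CharZero k] {ζ : k} (hζ : IsPrimitiveRoot ζ r) (hr : r ≠ 0) :
    ∑ j ∈ Finset.range r, eigenProj F r (ζ ^ j) = 1 := by
  have hζ0 : ζ ≠ 0 := hζ.ne_zero hr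
  simp only [eigenProj, ← Finset.smul_sum]
  rw [Finset.sum_comm]
  simp only [smul_pow, ← Finset.sum_smul]
  rw [Finset.sum_eq_single 0]
  · simp [← Nat.cast_smul_eq_nsmul k, smul_smul, hr]
  · intro b hb hb0
    have h1 : (ζ⁻¹) ^ b ≠ 1 := by
      rw [inv_pow, ne_eq, inv_eq_one]
      exact hζ.pow_ne_one_of_pos_of_lt hb0 (Finset.mem_range.mp hb)
    have h2 : ∑ j ∈ Finset.range r, ((ζ ^ j)⁻¹) ^ b = 0 := by
      have h3 : ∀ j, ((ζ ^ j)⁻¹) ^ b = ((ζ⁻¹) ^ b) ^ j := fun j ↦ by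
        rw [← inv_pow, ← pow_mul, ← pow_mul, mul_comm]
      simp only [h3]
      rw [geom_sum_eq h1, ← pow_mul, mul_comm, pow_mul, inv_pow, hζ.pow_eq_one]
      simp
    rw [h2, zero_smul]
  · simp [Nat.pos_iff_ne_zero, hr]

lemma eigenProj_commute {G : Module.End k V} (h : Commute F G) (s : ℕ) (ν : k) :
    Commute (eigenProj F r μ) (eigenProj G s ν) := by
  unfold eigenProj
  refine Commute.smul_left (Commute.smul_right ?_ _) _
  refine Commute.sum_left _ _ _ fun a _ ↦ Commute.sum_right _ _ _ fun b _ ↦ ?_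
  exact ((h.smul_left _).smul_right _).pow_pow _ _

lemma trace_eigenProj [FiniteDimensional k V] [CharZero k] (hr : r ≠ 0) (hF : F ^ r = 1)
    (hμ : μ ^ r = 1) :
    LinearMap.trace k V (eigenProj F r μ) = Module.finrank k (LinearMap.range (eigenProj F r μ)) :=
  LinearMap.IsProj.trace ⟨fun v ↦ ⟨v, rfl⟩, by
    rintro _ ⟨v, rfl⟩
    exact eigenProj_apply_of_eq hr hμ (apply_eigenProj hr hF hμ v)⟩

open Polynomial in
/-- In characteristic zero, an operator of finite prime order whose trace equals the dimension is
the identity. -/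
lemma eq_one_of_trace_eq_finrank [FiniteDimensional k V] [CharZero k] [IsAlgClosed k]
    (hr : r.Prime) (hF : F ^ r = 1)
    (htr : LinearMap.trace k V F = Module.finrank k V) : F = 1 := by
  have hr0 := hr.ne_zero
  have : NeZero r := ⟨hr0⟩
  have : NeZero (r : k) := ⟨by simpa using hr0⟩
  obtain ⟨ζ, hζ⟩ := HasEnoughRootsOfUnity.exists_primitiveRoot k r
  have hζj : ∀ j, (ζ ^ j) ^ r = 1 := fun j ↦ by rw [pow_right_comm, hζ.pow_eq_one, one_pow]
  let d : ℕ → ℕ := fun j ↦ Module.finrank k (LinearMap.range (eigenProj F r (ζ ^ j)))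
  have hpow : ∀ b j, F ^ b * eigenProj F r (ζ ^ j) = ((ζ ^ b) ^ j) • eigenProj F r (ζ ^ j) := by
    intro b j
    induction b with
    | zero => simp
    | succ b ih =>
      rw [pow_succ, mul_assoc, mul_eigenProj hr0 hF (hζj j), mul_smul_comm, ih, smul_smul]
      congr 1
      ring
  let Q : ℤ[X] := ∑ j ∈ Finset.range r, C (d j : ℤ) * X ^ j - C (Module.finrank k V : ℤ)
  have hQ : ∀ b, aeval (ζ ^ b) Q = LinearMap.trace k V (F ^ b) - Module.finrank k V := by
    intro b
    conv_rhs => rw [← mul_one (F ^ b), ← sum_eigenProj (F := F) hζ hr0, Finset.mul_sum]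
    simp only [hpow, map_sum, map_smul, trace_eigenProj hr0 hF (hζj _), Q, map_sub, map_mul,
      map_pow, aeval_X, aeval_C, d, smul_eq_mul]
    simp [mul_comm]
  have htrb : ∀ b ∈ Finset.range r, LinearMap.trace k V (F ^ b) = Module.finrank k V := by
    intro b hb
    rcases Nat.eq_zero_or_pos b with rfl | hb0
    · simp
    have hcop : b.Coprime r := (Nat.coprime_of_lt_prime hb0.ne' (Finset.mem_range.mp hb) hr).symm
    have hdvd : minpoly ℤ ζ ∣ Q := by
      refine minpoly.isIntegrallyClosed_dvd (hζ.isIntegral hr.pos) ?_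
      have := hQ 1
      rwa [pow_one, pow_one, htr, sub_self] at this
    rw [hζ.minpoly_eq_pow_coprime hcop] at hdvd
    rw [← sub_eq_zero, ← hQ]
    exact Polynomial.aeval_eq_zero_of_dvd_aeval_eq_zero hdvd (minpoly.aeval ℤ _)
  have htr0 : LinearMap.trace k V (eigenProj F r 1) = Module.finrank k V := by
    simp only [eigenProj, inv_one, one_smul, map_smul, map_sum]
    rw [Finset.sum_congr rfl htrb]
    simp [hr0]
  rw [trace_eigenProj hr0 hF (one_pow r), Nat.cast_inj] at htr0
  have htop := Submodule.eq_top_of_finrank_eq htr0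
  ext v
  obtain ⟨w, rfl⟩ : v ∈ LinearMap.range (eigenProj F r 1) := htop ▸ Submodule.mem_top
  rw [apply_eigenProj hr0 hF (one_pow r)]
  simp

end EigenProj

section Galois

variable {k H : Type*} [Field k] [Ring H] [HopfAlgebra k H]

/-- The linear map `h ⊗ m ↦ h₁ ⊗ φ(h₂) m`. -/
noncomputable def galoisMap (φ : Module.End k H) : Module.End k (H ⊗[k] H) :=
  (LinearMap.mul' k H ∘ₗ φ.rTensor H).lTensor H ∘ₗ
    (TensorProduct.assoc k H H H).toLinearMap ∘ₗ (comul (R := k)).rTensor H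

lemma galoisMap_tmul (φ : Module.End k H) {ι : Type*} {h : H} (r : Coalgebra.Repr k h ι) (m : H) :
    galoisMap φ (h ⊗ₜ m) = ∑ i ∈ r.index, r.left i ⊗ₜ[k] (φ (r.right i) * m) := by
  simp [galoisMap, ← r.eq, TensorProduct.sum_tmul]

lemma sum_counit_smul_left {ι : Type*} {h : H} (r : Coalgebra.Repr k h ι) :
    ∑ i ∈ r.index, counit (R := k) (r.right i) • r.left i = h := by
  have := congr(TensorProduct.rid k H $(Coalgebra.sum_tmul_counit_eq (R := k) r))
  rwa [map_sum, TensorProduct.rid_tmul, one_smul] at this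

lemma galoisMap_one_mul_galoisMap_antipode :
    galoisMap (k := k) (H := H) 1 * galoisMap (HopfAlgebra.antipode k (A := H)) = 1 := by
  refine TensorProduct.ext' fun h m ↦ ?_
  let L : H ⊗[k] (H ⊗[k] H) →ₗ[k] H ⊗[k] H :=
    (LinearMap.mulRight k m ∘ₗ LinearMap.mul' k H ∘ₗ
      (HopfAlgebra.antipode k (A := H)).lTensor H).lTensor H
  have h1 : ∀ x y : H, galoisMap (k := k) 1 (x ⊗ₜ (HopfAlgebra.antipode k y * m)) =
      L (TensorProduct.assoc k H H H (comul (R := k) x ⊗ₜ y)) := fun x y ↦ by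
    rw [galoisMap_tmul 1 (ℛ k x), ← (ℛ k x).eq]
    simp [L, TensorProduct.sum_tmul, mul_assoc]
  have r := ℛ k h
  have h2 := congr(L $(Coalgebra.coassoc_apply (R := k) h))
  rw [Module.End.mul_apply, galoisMap_tmul _ r, map_sum]
  simp only [h1]
  rw [← map_sum, ← map_sum]
  have h3 : ∑ i ∈ r.index, comul (R := k) (r.left i) ⊗ₜ[k] r.right i =
      (comul (R := k)).rTensor H (comul h) := by
    simp [← r.eq]
  rw [h3, h2, ← r.eq]
  simp only [map_sum, LinearMap.lTensor_tmul, L]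
  have h4 : ∀ x : H, (LinearMap.mulRight k m ∘ₗ LinearMap.mul' k H ∘ₗ
      (HopfAlgebra.antipode k (A := H)).lTensor H) (comul x) = counit (R := k) x • m := fun x ↦ by
    simp [LinearMap.comp_apply, HopfAlgebra.mul_antipode_lTensor_comul_apply,
      Algebra.smul_def]
  simp only [h4, TensorProduct.tmul_smul, TensorProduct.smul_tmul']
  rw [← TensorProduct.sum_tmul, sum_counit_smul_left r]
  simp

lemma isUnit_galoisMap_one [FiniteDimensional k H] : IsUnit (galoisMap (k := k) (H := H) 1) :=
  ⟨⟨_, _, galoisMap_one_mul_galoisMap_antipode,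
    mul_eq_one_comm.mp galoisMap_one_mul_galoisMap_antipode⟩, rfl⟩

lemma trace_eq_of_mul_eq {V : Type*} [AddCommGroup V] [Module k V] {A B P : Module.End k V}
    (hP : IsUnit P) (h : P * A = B * P) : LinearMap.trace k V A = LinearMap.trace k V B := by
  obtain ⟨P, rfl⟩ := hP
  have : A = ↑P⁻¹ * (B * P) := by rw [← h, Units.inv_mul_cancel_left]
  rw [this, LinearMap.trace_mul_comm, mul_assoc, Units.mul_inv, mul_one]

variable [FiniteDimensional k H]

lemma trace_mul_trace_mulRight_comp (F : H →ₐ[k] H)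
    (hF : ∀ h, comul (R := k) (F h) = F.toLinearMap.lTensor H (comul h)) (u : H) :
    LinearMap.trace k H F.toLinearMap *
        LinearMap.trace k H (LinearMap.mulRight k u ∘ₗ F.toLinearMap) =
      Module.finrank k H * LinearMap.trace k H (LinearMap.mulRight k u ∘ₗ F.toLinearMap) := by
  rw [← LinearMap.trace_one k H, ← LinearMap.trace_tensorProduct', ← LinearMap.trace_tensorProduct']
  refine trace_eq_of_mul_eq isUnit_galoisMap_one (TensorProduct.ext' fun h m ↦ ?_)
  have r := ℛ k h
  let s : Coalgebra.Repr k (F h) _ :=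
    { index := r.index, left := r.left, right := fun i ↦ F (r.right i),
      eq := by rw [hF, ← r.eq]; simp }
  simp only [Module.End.mul_apply, TensorProduct.map_tmul, AlgHom.toLinearMap_apply,
    galoisMap_tmul _ s, galoisMap_tmul _ r, map_sum]
  simp [s, mul_assoc]

lemma trace_mulRight_mul_trace_mulLeft {u v : H} (hu : comul (R := k) u = u ⊗ₜ u)
    (huv : u * v = 1) :
    LinearMap.trace k H (LinearMap.mulRight k u) * LinearMap.trace k H (LinearMap.mulLeft k v) =
      LinearMap.trace k H (LinearMap.mulRight k u) * Module.finrank k H := by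
  rw [← LinearMap.trace_one k H, ← LinearMap.trace_tensorProduct', ← LinearMap.trace_tensorProduct']
  refine trace_eq_of_mul_eq isUnit_galoisMap_one (TensorProduct.ext' fun h m ↦ ?_)
  have r := ℛ k h
  let s : Coalgebra.Repr k (h * u) _ :=
    { index := r.index, left := fun i ↦ r.left i * u, right := fun i ↦ r.right i * u,
      eq := by rw [Bialgebra.comul_mul, hu, ← r.eq]; simp [Finset.sum_mul] }
  simp only [Module.End.mul_apply, TensorProduct.map_tmul, LinearMap.mulRight_apply,
    galoisMap_tmul _ s, galoisMap_tmul _ r, map_sum]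
  have : ∀ x, x * u * (v * m) = x * m := fun x ↦ by rw [mul_assoc, ← mul_assoc u, huv, one_mul]
  simp [s, this]

end Galois

section JointEigen

variable {k V : Type*} [Field k] [CharZero k] [AddCommGroup V] [Module k V]
  [FiniteDimensional k V]

/-- If the joint spectrum of a pair of commuting operators of orders `q` and `p` is that of the
regular representation of `ℤ/q × ℤ/p`, the joint eigenspaces are one-dimensional. -/
lemma exists_joint_eigenvector {T R : Module.End k V} {p q : ℕ} (hp : p ≠ 0) (hq : q ≠ 0)
    (hT : T ^ q = 1) (hR : R ^ p = 1) (hTR : Commute T R) (hdim : Module.finrank k V = p * q)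
    (htr : ∀ a < q, ∀ b < p, ¬(a = 0 ∧ b = 0) → LinearMap.trace k V (T ^ a * R ^ b) = 0)
    {μ ν : k} (hμ : μ ^ q = 1) (hν : ν ^ p = 1) :
    ∃ x : V, x ≠ 0 ∧ T x = μ • x ∧ R x = ν • x ∧
      ∀ y, T y = μ • y → R y = ν • y → ∃ c : k, y = c • x := by
  let E := eigenProj T q μ * eigenProj R p ν
  have hE1 : ∀ v, T (E v) = μ • E v := fun v ↦ apply_eigenProj hq hT hμ _
  have hE2 : ∀ v, R (E v) = ν • E v := fun v ↦ by
    simp only [E, (eigenProj_commute hTR p ν).eq]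
    exact apply_eigenProj hp hR hν _
  have hE3 : ∀ y, T y = μ • y → R y = ν • y → E y = y := fun y h1 h2 ↦ by
    simp only [E, Module.End.mul_apply]
    rw [eigenProj_apply_of_eq hp hν h2, eigenProj_apply_of_eq hq hμ h1]
  have htrE : LinearMap.trace k V E = 1 := by
    simp only [E, eigenProj, smul_mul_smul_comm, Finset.sum_mul_sum, map_smul, map_sum, smul_pow]
    rw [Finset.sum_eq_single_of_mem 0 (by simpa [Nat.pos_iff_ne_zero] using hq),
      Finset.sum_eq_single_of_mem 0 (by simpa [Nat.pos_iff_ne_zero] using hp)]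
    · simp [hdim]
      field_simp
    · intro b hb hb0
      rw [htr 0 (Nat.pos_of_ne_zero hq) b (by simpa using hb) (by simp [hb0]), smul_zero]
    · intro a ha ha0
      refine Finset.sum_eq_zero fun b hb ↦ ?_
      rw [htr a (by simpa using ha) b (by simpa using hb) (by simp [ha0]), smul_zero]
  have hproj : LinearMap.IsProj (LinearMap.range E) E :=
    ⟨fun v ↦ ⟨v, rfl⟩, by rintro _ ⟨v, rfl⟩; exact hE3 _ (hE1 v) (hE2 v)⟩
  have hfin : Module.finrank k (LinearMap.range E) = 1 := by
    have := hproj.trace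
    rw [htrE] at this
    exact_mod_cast this.symm
  obtain ⟨⟨_, v, rfl⟩, hv0, hv⟩ := finrank_eq_one_iff'.mp hfin
  refine ⟨E v, fun h ↦ hv0 (Subtype.ext h), hE1 v, hE2 v, fun y h1 h2 ↦ ?_⟩
  obtain ⟨c, hc⟩ := hv ⟨y, y, hE3 y h1 h2⟩
  exact ⟨c, congr_arg Subtype.val hc.symm⟩

end JointEigen

section TracesOfTwists

lemma toLinearMap_pow' {k A : Type*} [Field k] [Ring A] [Algebra k A] (T : A →ₐ[k] A) (a : ℕ) :
    (T ^ a).toLinearMap = T.toLinearMap ^ a :=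
  map_pow (AlgHom.toEnd (R := k)) T a

lemma comul_pow_apply {k H : Type*} [Field k] [Ring H] [HopfAlgebra k H]
    {T : H →ₐ[k] H} (hT : ∀ h, comul (R := k) (T h) = T.toLinearMap.lTensor H (comul h))
    (a : ℕ) (h : H) :
    comul (R := k) ((T ^ a) h) = (T ^ a).toLinearMap.lTensor H (comul h) := by
  induction a with
  | zero => exact congr($((LinearMap.lTensor_id (R := k) H H).symm) (comul h))
  | succ a ih =>
    rw [pow_succ', AlgHom.mul_apply, hT, ih, ← LinearMap.comp_apply, ← LinearMap.lTensor_comp]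
    rfl

lemma pow_ne_one_of_prime {M : Type*} [Monoid M] {x : M} {r : ℕ} (hr : r.Prime) (hx : x ^ r = 1)
    (hx1 : x ≠ 1) {a : ℕ} (ha : a < r) (ha0 : a ≠ 0) : x ^ a ≠ 1 := by
  rw [ne_eq, ← orderOf_dvd_iff_pow_eq_one, orderOf_eq_prime (hp := ⟨hr⟩) hx hx1]
  exact fun h ↦ (Nat.le_of_dvd (Nat.pos_of_ne_zero ha0) h).not_gt ha

variable {k H : Type*} [Field k] [IsAlgClosed k] [CharZero k] [Ring H] [HopfAlgebra k H]
  [FiniteDimensional k H]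

lemma trace_mulRight_comp_eq_zero {F : H →ₐ[k] H} {r : ℕ} (hr : r.Prime) (hFr : F ^ r = 1)
    (hF1 : F ≠ 1) (hF : ∀ h, comul (R := k) (F h) = F.toLinearMap.lTensor H (comul h)) (u : H) :
    LinearMap.trace k H (LinearMap.mulRight k u ∘ₗ F.toLinearMap) = 0 := by
  by_contra h
  refine hF1 (AlgHom.toLinearMap_injective ?_)
  refine eq_one_of_trace_eq_finrank hr (by rw [← toLinearMap_pow', hFr]; rfl) ?_
  exact mul_right_cancel₀ h (trace_mul_trace_mulRight_comp F hF u)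

lemma trace_mulRight_eq_zero {u v : H} {r : ℕ} (hr : r.Prime) (hv : v ^ r = 1) (hv1 : v ≠ 1)
    (huv : u * v = 1) (hu : comul (R := k) u = u ⊗ₜ u) :
    LinearMap.trace k H (LinearMap.mulRight k u) = 0 := by
  by_contra h
  have h1 := eq_one_of_trace_eq_finrank (F := LinearMap.mulLeft k v) hr
    (by rw [LinearMap.pow_mulLeft, hv, LinearMap.mulLeft_one]; rfl)
    (mul_left_cancel₀ h (trace_mulRight_mul_trace_mulLeft hu huv))
  exact hv1 (by simpa using congr($h1 1))

/-- The joint eigenspaces of `T` and of right multiplication by `g` are one-dimensional. -/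
lemma exists_joint_eigenvector_mulRight {p q : ℕ} (hp : p.Prime) (hq : q.Prime)
    (hdim : Module.finrank k H = p * q) {g : H} (hg : comul (R := k) g = g ⊗ₜ g)
    (hgp : g ^ p = 1) (hg1 : g ≠ 1) {T : H →ₐ[k] H} (hTq : T ^ q = 1) (hT1 : T ≠ 1)
    (hT : ∀ h, comul (R := k) (T h) = T.toLinearMap.lTensor H (comul h)) (hTg : T g = g)
    {μ ν : k} (hμ : μ ^ q = 1) (hν : ν ^ p = 1) :
    ∃ x : H, x ≠ 0 ∧ T x = μ • x ∧ x * g = ν • x ∧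
      ∀ y, T y = μ • y → y * g = ν • y → ∃ c : k, y = c • x := by
  have hcomm : Commute T.toLinearMap (LinearMap.mulRight k g) := by
    ext x
    simp [hTg]
  refine exists_joint_eigenvector (T := T.toLinearMap) (R := LinearMap.mulRight k g) hp.ne_zero
    hq.ne_zero (by rw [← toLinearMap_pow', hTq]; rfl)
    (by rw [LinearMap.pow_mulRight, hgp, LinearMap.mulRight_one]; rfl) hcomm hdim ?_ hμ hν
  intro a ha b hb hab
  rw [(hcomm.pow_pow a b).eq, LinearMap.pow_mulRight, ← toLinearMap_pow']
  by_cases ha0 : a = 0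
  · subst ha0
    have hb0 : b ≠ 0 := by simpa using hab
    have hbp := pow_ne_one_of_prime hp hgp hg1 hb hb0
    have hinv : g ^ b * g ^ (p - b) = 1 := by rw [← pow_add, Nat.add_sub_cancel' hb.le, hgp]
    refine trace_mulRight_eq_zero hp (v := g ^ (p - b)) ?_ ?_ hinv ?_
    · rw [pow_right_comm, hgp, one_pow]
    · intro h
      rw [h, mul_one] at hinv
      exact hbp hinv
    · rw [Bialgebra.comul_pow, hg, Algebra.TensorProduct.tmul_pow]
  · exact trace_mulRight_comp_eq_zero hq (by rw [pow_right_comm, hTq, one_pow])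
      (pow_ne_one_of_prime hq hTq hT1 ha ha0) (comul_pow_apply hT a) _

end TracesOfTwists

section StrongGrading

variable {k H : Type*} [Field k] [Ring H] [HopfAlgebra k H]

lemma sum_counit_comp_smul_left {F : Module.End k H}
    (hF : ∀ h, comul (R := k) (F h) = F.lTensor H (comul h)) {ι : Type*} {h : H}
    (r : Coalgebra.Repr k h ι) :
    ∑ i ∈ r.index, counit (R := k) (F (r.right i)) • r.left i = F h := by
  let s : Coalgebra.Repr k (F h) ι :=
    { index := r.index, left := r.left, right := fun i ↦ F (r.right i),
      eq := by rw [hF, ← r.eq]; simp }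
  exact sum_counit_smul_left s

lemma sum_antipode_mul_comp {F : Module.End k H}
    (hF : ∀ h, comul (R := k) (F h) = F.lTensor H (comul h)) {ι : Type*} {h : H}
    (r : Coalgebra.Repr k h ι) :
    ∑ i ∈ r.index, HopfAlgebra.antipode k (r.left i) * F (r.right i) =
      counit (R := k) (F h) • (1 : H) := by
  let s : Coalgebra.Repr k (F h) ι :=
    { index := r.index, left := r.left, right := fun i ↦ F (r.right i),
      eq := by rw [hF, ← r.eq]; simp }
  exact HopfAlgebra.sum_antipode_mul_eq_smul s

/-- The grading of `H` by the eigenspaces of `T` is strong. -/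
lemma exists_eigenvector_mul_ne_zero [CharZero k] {q : ℕ} (hq : q.Prime) {T : H →ₐ[k] H}
    (hTq : T ^ q = 1) (hT1 : T ≠ 1)
    (hT : ∀ h, comul (R := k) (T h) = T.toLinearMap.lTensor H (comul h))
    {μ : k} (hμ : μ ^ q = 1) {x : H} (hx : x ≠ 0) :
    ∃ z : H, T z = μ • z ∧ z * x ≠ 0 := by
  by_contra! hcon
  have hTq' : T.toLinearMap ^ q = 1 := by rw [← toLinearMap_pow', hTq]; rfl
  let P := eigenProj T.toLinearMap q μ
  have hP : ∀ h, comul (R := k) (P h) = P.lTensor H (comul h) := fun h ↦ by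
    have hpow : ∀ a, comul (R := k) ((T.toLinearMap ^ a) h) =
        (T.toLinearMap ^ a).lTensor H (comul h) := fun a ↦ by
      rw [← toLinearMap_pow']
      exact comul_pow_apply hT a h
    have hsum : P.lTensor H = (q : k)⁻¹ •
        ∑ a ∈ Finset.range q, (μ⁻¹ ^ a) • (T.toLinearMap ^ a).lTensor H := by
      simp only [P, eigenProj, LinearMap.lTensor_smul, smul_pow, ← LinearMap.coe_lTensorHom,
        map_sum, map_smul]
    rw [hsum]
    simp [P, eigenProj, smul_pow, hpow]
  have hcounit : ∀ y, counit (R := k) (P y) = 0 := fun y ↦ by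
    have h1 := congr($(sum_antipode_mul_comp hP (ℛ k y)) * x)
    rw [Finset.sum_mul, Finset.sum_eq_zero, smul_mul_assoc, one_mul, eq_comm, smul_eq_zero] at h1
    · exact h1.resolve_right hx
    · intro i _
      rw [mul_assoc, hcon _ (apply_eigenProj hq.ne_zero hTq' hμ _), mul_zero]
  let χ : Fin q → (H →ₐ[k] k) := fun a ↦ (Bialgebra.counitAlgHom k H).comp (T ^ (a : ℕ))
  have hinj : Function.Injective χ := by
    intro a b hab
    have hTab : T ^ (a : ℕ) = T ^ (b : ℕ) := by
      ext h
      have h1 := sum_counit_comp_smul_left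
        (F := (T ^ (a : ℕ)).toLinearMap) (comul_pow_apply hT a) (ℛ k h)
      have h2 := sum_counit_comp_smul_left
        (F := (T ^ (b : ℕ)).toLinearMap) (comul_pow_apply hT b) (ℛ k h)
      have h3 : ∀ y, counit (R := k) ((T ^ (a : ℕ)) y) = counit (R := k) ((T ^ (b : ℕ)) y) :=
        fun y ↦ congr($hab y)
      simp only [AlgHom.toLinearMap_apply, h3] at h1 h2
      exact h1.symm.trans h2
    have hord := orderOf_eq_prime (hp := ⟨hq⟩) hTq hT1
    refine Fin.ext (pow_injOn_Iio_orderOf (x := T) ?_ ?_ hTab)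
    · simp [hord]
    · simp [hord]
  have hli := (linearIndependent_algHom_toLinearMap k H k).comp χ hinj
  rw [Fintype.linearIndependent_iff] at hli
  have h0 := hli (fun a ↦ μ⁻¹ ^ (a : ℕ)) (by
    ext y
    have h1 := hcounit y
    simp only [P, eigenProj, LinearMap.smul_apply, LinearMap.sum_apply, smul_pow, map_smul,
      map_sum, smul_eq_mul, mul_eq_zero, inv_eq_zero, Nat.cast_eq_zero, hq.ne_zero, false_or,
      Finset.sum_range, ← toLinearMap_pow'] at h1
    simpa [χ] using h1) ⟨0, hq.pos⟩
  simp at h0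

end StrongGrading

section Character

/-- If every element of `A` acts on a nonzero vector by a scalar, these scalars form a
character of `A`. -/
lemma exists_algHom_of_mul_eq_smul {k A : Type*} [Field k] [Ring A] [Algebra k A] {v : A}
    (hv : v ≠ 0) (h : ∀ a : A, ∃ c : k, a * v = c • v) :
    ∃ l : A →ₐ[k] k, ∀ a, a * v = l a • v := by
  choose l hl using h
  have hinj : ∀ {c d : k}, c • v = d • v → c = d := fun h ↦ smul_left_injective k hv h
  exact ⟨AlgHom.ofLinearMap
    { toFun := l
      map_add' := fun a b ↦ hinj (by rw [← hl, add_mul, hl, hl, add_smul])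
      map_smul' := fun c a ↦ hinj (by rw [← hl, smul_mul_assoc, hl, smul_smul]; rfl) }
    (hinj (by simp [← hl]))
    (fun a b ↦ hinj (by
      change l (a * b) • v = (l a * l b) • v
      rw [← hl, mul_assoc, hl b, mul_smul_comm, hl a, smul_smul, mul_comm])), hl⟩

variable {k A : Type*} [Field k] [IsAlgClosed k] [CharZero k] [Ring A] [Algebra k A]
  [FiniteDimensional k A]

/-- If the joint eigenspace of `T` and right multiplication by `g` for the eigenvalues
`κ`, `ν` contains a `g`-eigenvector with eigenvalue `ν`, where `κ` is a primitive root of unity,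
then `A` has a character with value `ν` at `g`. -/
lemma exists_algHom_apply_eq {q : ℕ} (hq : q ≠ 0) {g : A} {T : A →ₐ[k] A} (hTq : T ^ q = 1)
    {κ ν : k} (hκ : IsPrimitiveRoot κ q)
    (hV : ∀ μ : k, μ ^ q = 1 → ∃ x : A, x ≠ 0 ∧ T x = μ • x ∧ x * g = ν • x ∧
      ∀ y, T y = μ • y → y * g = ν • y → ∃ c : k, y = c • x)
    (hstrong : ∀ μ : k, μ ^ q = 1 → ∀ x : A, x ≠ 0 → ∃ z : A, T z = μ • z ∧ z * x ≠ 0)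
    {e y : A} (hTe : T e = e) (heg : e * g = ν • e) (hxe : ∀ x : A, x * g = ν • x → x * e = x)
    (hex : ∀ x : A, g * x = ν • x → e * x = x) (hTg : T g = g)
    (hy0 : y ≠ 0) (hTy : T y = κ • y) (hyg : y * g = ν • y) (hgy : g * y = ν • y)
    (hge : g * e = ν • e) :
    ∃ l : A →ₐ[k] k, l g = ν := by
  have he0 : e ≠ 0 := by
    rintro rfl
    exact hy0 (by rw [← hxe y hyg, mul_zero])
  have hκpow : ∀ m, (κ ^ m) ^ q = 1 := fun m ↦ by rw [pow_right_comm, hκ.pow_eq_one, one_pow]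
  have hTpow : ∀ m, T (y ^ m * e) = κ ^ m • (y ^ m * e) := fun m ↦ by
    rw [map_mul, map_pow, hTy, hTe, smul_pow, smul_mul_assoc]
  have hpowg : ∀ m, y ^ m * e * g = ν • (y ^ m * e) := fun m ↦ by
    rw [mul_assoc, heg, mul_smul_comm]
  have hgpow : ∀ m, g * (y ^ m * e) = ν • (y ^ m * e) := fun m ↦ by
    cases m with
    | zero => simpa using hge
    | succ m => rw [pow_succ', mul_assoc, ← mul_assoc, hgy, smul_mul_assoc]
  -- `y` is not nilpotent
  obtain ⟨w, hwy⟩ : ∃ w : A, w * y = e := by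
    have hκinv : (κ⁻¹) ^ q = 1 := by rw [inv_pow, hκ.pow_eq_one, inv_one]
    obtain ⟨z, hTz, hz⟩ := hstrong κ⁻¹ hκinv y hy0
    obtain ⟨x, -, -, -, hx⟩ := hV 1 (one_pow q)
    obtain ⟨c, hc⟩ := hx (z * y) (by
      rw [map_mul, hTz, hTy, smul_mul_smul_comm, inv_mul_cancel₀ (hκ.ne_zero hq)])
      (by rw [mul_assoc, hyg, mul_smul_comm])
    obtain ⟨d, hd⟩ := hx e (by rw [hTe, one_smul]) heg
    have hc0 : c ≠ 0 := by
      rintro rfl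
      exact hz (by rw [hc, zero_smul])
    exact ⟨(d * c⁻¹) • z, by rw [smul_mul_assoc, hc, hd, smul_smul, inv_mul_cancel_right₀ hc0]⟩
  have hye : ∀ m, y ^ m * e ≠ 0 := by
    intro m
    induction m with
    | zero => simpa using he0
    | succ m ih =>
      intro h
      have h1 : w * (y ^ (m + 1) * e) = y ^ m * e := by
        rw [pow_succ', mul_assoc, ← mul_assoc, hwy, hex _ (hgpow m)]
      rw [h, mul_zero] at h1
      exact ih h1.symm
  -- the elements `y ^ m * e` span `{x | x * g = ν • x}`
  let W : Submodule k A := Submodule.span k (Set.range fun m : ℕ ↦ y ^ m * e)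
  have hW : ∀ x, x * g = ν • x → x ∈ W := by
    intro x hx
    have hsum := congr($(sum_eigenProj (F := T.toLinearMap) hκ hq) x)
    rw [LinearMap.sum_apply, Module.End.one_apply] at hsum
    rw [← hsum]
    refine Submodule.sum_mem _ fun j _ ↦ ?_
    have hTq' : T.toLinearMap ^ q = 1 := by rw [← toLinearMap_pow', hTq]; rfl
    obtain ⟨u, -, -, -, hu⟩ := hV (κ ^ j) (hκpow j)
    have hcomm : Commute T.toLinearMap (LinearMap.mulRight k g) := by
      ext x
      simp [hTg]
    obtain ⟨c, hc⟩ := hu _ (apply_eigenProj hq hTq' (hκpow j) x) (by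
      have h1 : Commute (eigenProj T.toLinearMap q (κ ^ j)) (LinearMap.mulRight k g) := by
        unfold eigenProj
        exact Commute.smul_left (Commute.sum_left _ _ _ fun a _ ↦ (hcomm.smul_left _).pow_left _) _
      have h2 := congr($h1.eq x)
      simp only [Module.End.mul_apply, LinearMap.mulRight_apply, hx, map_smul] at h2
      exact h2.symm)
    obtain ⟨d, hd⟩ := hu _ (hTpow j) (hpowg j)
    have hd0 : d ≠ 0 := by
      rintro rfl
      exact hye j (by rw [hd, zero_smul])
    have : u = d⁻¹ • (y ^ j * e) := by rw [hd, smul_smul, inv_mul_cancel₀ hd0, one_smul]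
    rw [hc, this]
    exact W.smul_mem _ (W.smul_mem _ (Submodule.subset_span ⟨j, rfl⟩))
  have hgW : ∀ x ∈ W, g * x = ν • x := by
    intro x hx
    induction hx using Submodule.span_induction with
    | mem x hx => obtain ⟨m, rfl⟩ := hx; exact hgpow m
    | zero => simp
    | add x y _ _ hx hy => rw [mul_add, hx, hy, smul_add]
    | smul c x _ hx => rw [mul_smul_comm, hx, smul_comm]
  have hWg : ∀ x ∈ W, x * g = ν • x := by
    intro x hx
    induction hx using Submodule.span_induction with
    | mem x hx => obtain ⟨m, rfl⟩ := hx; exact hpowg m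
    | zero => simp
    | add x y _ _ hx hy => rw [add_mul, hx, hy, smul_add]
    | smul c x _ hx => rw [smul_mul_assoc, hx, smul_comm]
  let Y : Module.End k W := (LinearMap.mulLeft k y).restrict
    (p := W) (q := W) fun x hx ↦ hW _ (by
      rw [LinearMap.mulLeft_apply, mul_assoc, hWg x hx, mul_smul_comm])
  have heW : e ∈ W := hW e heg
  have : Nontrivial W := ⟨⟨⟨e, heW⟩, 0, fun h ↦ he0 congr(($h : A))⟩⟩
  obtain ⟨c, hc⟩ := Module.End.exists_eigenvalue Y
  obtain ⟨⟨v, hvW⟩, hv⟩ := hc.exists_hasEigenvector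
  have hv0 : v ≠ 0 := fun h ↦ hv.2 (Subtype.ext h)
  have hyv : y * v = c • v := congr(($hv.apply_eq_smul : A))
  have hev : e * v = v := hex v (hgW v hvW)
  have hypow : ∀ m : ℕ, y ^ m * v = c ^ m • v := fun m ↦ by
    induction m with
    | zero => simp
    | succ m ih => rw [pow_succ, mul_assoc, hyv, mul_smul_comm, ih, smul_smul, pow_succ']
  have hWv : ∀ x ∈ W, ∃ d : k, x * v = d • v := by
    intro x hx
    induction hx using Submodule.span_induction with
    | mem x hx => obtain ⟨m, rfl⟩ := hx; exact ⟨c ^ m, by rw [mul_assoc, hev, hypow]⟩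
    | zero => exact ⟨0, by simp⟩
    | add x y _ _ hx hy =>
      obtain ⟨d, hd⟩ := hx
      obtain ⟨d', hd'⟩ := hy
      exact ⟨d + d', by rw [add_mul, hd, hd', add_smul]⟩
    | smul b x _ hx =>
      obtain ⟨d, hd⟩ := hx
      exact ⟨b * d, by rw [smul_mul_assoc, hd, smul_smul]⟩
  obtain ⟨l, hl⟩ := exists_algHom_of_mul_eq_smul hv0 fun a ↦ by
    obtain ⟨d, hd⟩ := hWv (a * e) (hW _ (by rw [mul_assoc, heg, mul_smul_comm]))
    exact ⟨d, by rw [← hd, mul_assoc, hev]⟩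
  exact ⟨l, smul_left_injective k hv0 ((hl g).symm.trans (hgW v hvW))⟩

end Character

section CyclicIdempotent

variable {k A : Type*} [Field k] [CharZero k] [Ring A] [Algebra k A]

/-- The idempotent of the character `g ↦ ν` of the cyclic group generated by `g`. -/
lemma exists_cyclic_idempotent {p : ℕ} (hp : p ≠ 0) {g : A} (hg : g ^ p = 1) {ν : k}
    (hν : ν ^ p = 1) :
    ∃ e : A, g * e = ν • e ∧ e * g = ν • e ∧ (∀ x, g * x = ν • x → e * x = x) ∧
      (∀ x, x * g = ν • x → x * e = x) ∧ ∀ T : A →ₐ[k] A, T g = g → T e = e := by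
  let e : A := (p : k)⁻¹ • ∑ b ∈ Finset.range p, (ν⁻¹ • g) ^ b
  have hl : ∀ x, eigenProj (LinearMap.mulLeft k g) p ν x = e * x := fun x ↦ by
    simp [eigenProj, e, smul_pow, Finset.sum_mul, LinearMap.pow_mulLeft]
  have hr : ∀ x, eigenProj (LinearMap.mulRight k g) p ν x = x * e := fun x ↦ by
    simp [eigenProj, e, smul_pow, Finset.mul_sum, LinearMap.pow_mulRight]
  refine ⟨e, ?_, ?_, fun x hx ↦ ?_, fun x hx ↦ ?_, fun T hT ↦ by simp [e, hT]⟩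
  · have := apply_eigenProj (F := LinearMap.mulLeft k g) hp
      (by rw [LinearMap.pow_mulLeft, hg, LinearMap.mulLeft_one]; rfl) hν 1
    simpa [hl] using this
  · have := apply_eigenProj (F := LinearMap.mulRight k g) hp
      (by rw [LinearMap.pow_mulRight, hg, LinearMap.mulRight_one]; rfl) hν 1
    simpa [hr] using this
  · rw [← hl, eigenProj_apply_of_eq hp hν hx]
  · rw [← hr, eigenProj_apply_of_eq hp hν hx]

end CyclicIdempotent

section Core

variable {k A : Type*} [Field k] [IsAlgClosed k] [CharZero k] [Ring A] [Algebra k A]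
  [FiniteDimensional k A]

lemma exists_algHom_apply_eq_of_lt {p q : ℕ} (hp : p.Prime) (hq : q.Prime) (hpq : p < q) {g : A}
    (hgp : g ^ p = 1) {T : A →ₐ[k] A} (hTq : T ^ q = 1) (hTg : T g = g)
    (hV : ∀ μ ν : k, μ ^ q = 1 → ν ^ p = 1 → ∃ x : A, x ≠ 0 ∧ T x = μ • x ∧ x * g = ν • x ∧
      ∀ y, T y = μ • y → y * g = ν • y → ∃ c : k, y = c • x)
    (hstrong : ∀ μ : k, μ ^ q = 1 → ∀ x : A, x ≠ 0 → ∃ z : A, T z = μ • z ∧ z * x ≠ 0)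
    {ν : k} (hν : ν ^ p = 1) : ∃ l : A →ₐ[k] k, l g = ν := by
  have : NeZero q := ⟨hq.ne_zero⟩
  have : NeZero (q : k) := ⟨by simpa using hq.ne_zero⟩
  obtain ⟨ζ, hζ⟩ := HasEnoughRootsOfUnity.exists_primitiveRoot k q
  have hζj : ∀ j, (ζ ^ j) ^ q = 1 := fun j ↦ by rw [pow_right_comm, hζ.pow_eq_one, one_pow]
  choose x hx0 hTx hxg hx using fun j : ℕ ↦ hV (ζ ^ j) ν (hζj j) hν
  have hgx : ∀ j, ∃ c : k, g * x j = c • x j := fun j ↦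
    hx j _ (by rw [map_mul, hTg, hTx, mul_smul_comm]) (by rw [mul_assoc, hxg, mul_smul_comm])
  choose c hc using hgx
  have hcp : ∀ j, c j ^ p = 1 := fun j ↦ by
    have h : ∀ m : ℕ, g ^ m * x j = c j ^ m • x j := fun m ↦ by
      induction m with
      | zero => simp
      | succ m ih => rw [pow_succ, mul_assoc, hc, mul_smul_comm, ih, smul_smul, pow_succ']
    have h1 := h p
    rw [hgp, one_mul] at h1
    exact smul_left_injective k (hx0 j) (h1.symm.trans (one_smul k _).symm)
  obtain ⟨i, hi, j, hj, hij, hcij⟩ : ∃ i ∈ Finset.range q, ∃ j ∈ Finset.range q, i ≠ j ∧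
      c i = c j := by
    refine Finset.exists_ne_map_eq_of_card_lt_of_maps_to
      (t := Polynomial.nthRootsFinset p (1 : k)) ?_ fun j _ ↦ ?_
    · rw [Finset.card_range]
      refine lt_of_le_of_lt ?_ hpq
      classical
      exact (Multiset.toFinset_card_le _).trans (Polynomial.card_nthRoots p 1)
    · exact (Polynomial.mem_nthRootsFinset hp.pos 1).mpr (hcp j)
  obtain ⟨e, hge, heg, hex, hxe, hTe⟩ := exists_cyclic_idempotent hp.ne_zero hgp hν
  obtain ⟨f, -, hfg, hfx, -, hTf⟩ := exists_cyclic_idempotent hp.ne_zero hgp (hcp i)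
  replace hTe := hTe T hTg
  replace hTf := hTf T hTg
  have hfi : f * x i = x i := hfx _ (hc i)
  have hfj : f * x j = x j := hfx _ (hcij ▸ hc j)
  have hζi0 : ζ ^ i ≠ 0 := pow_ne_zero _ (hζ.ne_zero hq.ne_zero)
  have hζinv : ((ζ ^ i)⁻¹) ^ q = 1 := by rw [inv_pow, hζj, inv_one]
  obtain ⟨z, hTz, hz⟩ := hstrong _ hζinv (x i) (hx0 i)
  -- `z * x i` is a nonzero multiple of `e`
  obtain ⟨t, ht0, ht⟩ : ∃ t : k, t ≠ 0 ∧ z * x i = t • e := by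
    obtain ⟨u, -, -, -, hu⟩ := hV 1 ν (one_pow q) hν
    obtain ⟨a, ha⟩ := hu (z * x i)
      (by rw [map_mul, hTz, hTx, smul_mul_smul_comm, inv_mul_cancel₀ hζi0])
      (by rw [mul_assoc, hxg, mul_smul_comm])
    obtain ⟨b, hb⟩ := hu e (by rw [hTe, one_smul]) heg
    have he0 : e ≠ 0 := by
      rintro rfl
      exact hx0 i (by rw [← hxe _ (hxg i), mul_zero])
    have ha0 : a ≠ 0 := by
      rintro rfl
      exact hz (by rw [ha, zero_smul])
    have hb0 : b ≠ 0 := by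
      rintro rfl
      exact he0 (by rw [hb, zero_smul])
    exact ⟨a * b⁻¹, by positivity, by rw [ha, hb, smul_smul, inv_mul_cancel_right₀ hb0]⟩
  let w := e * z * f
  have hTw : T w = (ζ ^ i)⁻¹ • w := by
    simp [w, hTe, hTf, hTz]
  have hwg : w * g = c i • w := by simp only [w]; rw [mul_assoc, hfg, mul_smul_comm]
  have hgw : g * w = ν • w := by simp only [w, mul_assoc]; rw [← mul_assoc, hge, smul_mul_assoc]
  have hwx : w * x i = t • e := by
    simp only [w]
    rw [mul_assoc, hfi, mul_assoc, ht, mul_smul_comm, hex e hge]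
  have hxwx : x i * w * x i = t • x i := by
    rw [mul_assoc, hwx, mul_smul_comm, hxe _ (hxg i)]
  obtain ⟨s, hs⟩ : ∃ s : k, x i * w = s • f := by
    obtain ⟨u, -, -, -, hu⟩ := hV 1 (c i) (one_pow q) (hcp i)
    obtain ⟨a, ha⟩ := hu (x i * w)
      (by rw [map_mul, hTw, hTx, smul_mul_smul_comm, mul_inv_cancel₀ hζi0])
      (by rw [mul_assoc, hwg, mul_smul_comm])
    obtain ⟨b, hb⟩ := hu f (by rw [hTf, one_smul]) hfg
    have hb0 : b ≠ 0 := by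
      rintro rfl
      exact hx0 i (by rw [← hfi, hb, zero_smul, zero_mul])
    exact ⟨a * b⁻¹, by rw [ha, hb, smul_smul, inv_mul_cancel_right₀ hb0]⟩
  have hst : s = t := by
    rw [hs, smul_mul_assoc, hfi] at hxwx
    exact smul_left_injective k (hx0 i) hxwx
  have hκ : IsPrimitiveRoot ((ζ ^ i)⁻¹ * ζ ^ j) q := by
    have h1 : ((ζ ^ i)⁻¹ * ζ ^ j) ^ q = 1 := by rw [mul_pow, hζinv, hζj, mul_one]
    have h2 : (ζ ^ i)⁻¹ * ζ ^ j ≠ 1 := fun h ↦ hij <|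
      hζ.pow_inj (Finset.mem_range.mp hi) (Finset.mem_range.mp hj)
        (by rwa [inv_mul_eq_one₀ hζi0] at h)
    rw [← orderOf_eq_prime (hp := ⟨hq⟩) h1 h2]
    exact IsPrimitiveRoot.orderOf _
  refine exists_algHom_apply_eq (y := w * x j) hq.ne_zero hTq hκ (fun μ hμ ↦ hV μ ν hμ hν) hstrong
    hTe heg hxe hex hTg ?_ ?_ ?_ ?_ hge
  · intro h
    have h1 : x i * (w * x j) = t • x j := by rw [← mul_assoc, hs, smul_mul_assoc, hfj, hst]
    rw [h, mul_zero, eq_comm, smul_eq_zero] at h1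
    exact h1.elim ht0 (hx0 j)
  · rw [map_mul, hTw, hTx, smul_mul_smul_comm]
  · rw [mul_assoc, hxg, mul_smul_comm]
  · rw [← mul_assoc, hgw, smul_mul_assoc]

/-- The key step: a Hopf algebra of dimension `p * q`, `p < q`, with a group-like element `g` of
order `p` and a twist `T` of order `q` fixing `g` has a character that is nontrivial on `g`. -/
lemma exists_algHom_apply_ne_one {H : Type*} [Ring H] [HopfAlgebra k H]
    [FiniteDimensional k H] {p q : ℕ} (hp : p.Prime) (hq : q.Prime) (hpq : p < q)
    (hdim : Module.finrank k H = p * q) {g : H} (hg : comul (R := k) g = g ⊗ₜ g)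
    (hgp : g ^ p = 1) (hg1 : g ≠ 1) {T : H →ₐ[k] H} (hTq : T ^ q = 1) (hT1 : T ≠ 1)
    (hT : ∀ h, comul (R := k) (T h) = T.toLinearMap.lTensor H (comul h)) (hTg : T g = g) :
    ∃ l : H →ₐ[k] k, l g ≠ 1 := by
  have : NeZero p := ⟨hp.ne_zero⟩
  have : NeZero (p : k) := ⟨by simpa using hp.ne_zero⟩
  obtain ⟨ν, hν⟩ := HasEnoughRootsOfUnity.exists_primitiveRoot k p
  obtain ⟨l, hl⟩ := exists_algHom_apply_eq_of_lt hp hq hpq hgp hTq hTg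
    (fun μ ν hμ hν ↦ exists_joint_eigenvector_mulRight hp hq hdim hg hgp hg1 hTq hT1 hT hTg hμ hν)
    (fun μ hμ x hx ↦ exists_eigenvector_mul_ne_zero hq hTq hT1 hT hμ hx) hν.pow_eq_one
  exact ⟨l, hl ▸ hν.ne_one hp.one_lt⟩

end Core

namespace HopfDual

variable {k H : Type*} [Field k] [Ring H] [HopfAlgebra k H] [FiniteDimensional k H]

lemma eq_of_forall_apply_eq {a b : H} (h : ∀ f : HopfDual k H, f a = f b) : a = b := by
  rw [← sub_eq_zero, ← Module.forall_dual_apply_eq_zero_iff k]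
  intro f
  simpa [sub_eq_zero] using h ((toDual k H).symm f)

lemma eq_of_forall_pairing_eq {s t : H ⊗[k] H}
    (h : ∀ f g : HopfDual k H, pairing k H (f ⊗ₜ g) s = pairing k H (f ⊗ₜ g) t) : s = t := by
  rw [← sub_eq_zero, ← Module.forall_dual_apply_eq_zero_iff k]
  intro F
  obtain ⟨x, rfl⟩ := (pairing k H).surjective F
  rw [map_sub, sub_eq_zero]
  induction x with
  | zero => simp
  | tmul f g => exact h f g
  | add x y hx hy => rw [map_add, LinearMap.add_apply, LinearMap.add_apply, hx, hy]

lemma pairing_tmul_comul (f g : HopfDual k H) (a : H) :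
    pairing k H (f ⊗ₜ g) (comul a) = (f * g) a := by
  rw [mul_apply (ℛ k a), ← (ℛ k a).eq]
  simp

/-- Group-like elements of `H*` are the algebra homomorphisms `H → k`. -/
noncomputable def groupLikeEquiv : GroupLike k (HopfDual k H) ≃ (H →ₐ[k] k) where
  toFun χ := AlgHom.ofLinearMap (toDual k H χ.val) χ.2.counit_eq_one fun a b ↦ by
    rw [toDual_apply, ← pairing_comul, χ.2.comul_eq_tmul_self]
    rfl
  invFun l := ⟨(toDual k H).symm l.toLinearMap,
    map_one l, pairing_ext fun a b ↦ by rw [pairing_comul]; exact map_mul l a b⟩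
  left_inv _ := rfl
  right_inv _ := rfl

@[simp] lemma groupLikeEquiv_apply (χ : GroupLike k (HopfDual k H)) (a : H) :
    groupLikeEquiv χ a = χ.val a := rfl

/-- The algebra endomorphism `h ↦ h₁ χ(h₂)`. -/
noncomputable def twist (χ : GroupLike k (HopfDual k H)) : H →ₐ[k] H :=
  ((Algebra.TensorProduct.rid k k H).toAlgHom.comp
    (Algebra.TensorProduct.map (AlgHom.id k H) (groupLikeEquiv χ))).comp (Bialgebra.comulAlgHom k H)

lemma apply_twist (χ : GroupLike k (HopfDual k H)) (f : HopfDual k H) (a : H) :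
    f (twist χ a) = (f * χ.val) a := by
  rw [mul_apply (ℛ k a)]
  simp only [twist, AlgHom.comp_apply, Bialgebra.comulAlgHom_apply]
  rw [← (ℛ k a).eq]
  simp [mul_comm]

lemma apply_twist_pow (χ : GroupLike k (HopfDual k H)) (f : HopfDual k H) (m : ℕ) (a : H) :
    f ((twist χ ^ m) a) = (f * χ.val ^ m) a := by
  induction m generalizing f with
  | zero => simp
  | succ m ih => rw [pow_succ', AlgHom.mul_apply, apply_twist, ih, mul_assoc, ← pow_succ']

lemma comul_twist (χ : GroupLike k (HopfDual k H)) (a : H) :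
    comul (R := k) (twist χ a) = (twist χ).toLinearMap.lTensor H (comul a) := by
  refine eq_of_forall_pairing_eq fun f g ↦ ?_
  rw [pairing_tmul_comul, apply_twist, mul_assoc, mul_apply (ℛ k a), ← (ℛ k a).eq]
  simp [apply_twist]

variable (k) in
/-- Evaluation at `a`, as an element of the double dual. -/
noncomputable def eval (a : H) : HopfDual k (HopfDual k H) :=
  (toDual k _).symm (LinearMap.applyₗ a ∘ₗ (toDual k H).toLinearMap)

@[simp] lemma eval_apply (a : H) (f : HopfDual k H) : eval k a f = f a := rfl

lemma eval_injective : Function.Injective (eval k : H → HopfDual k (HopfDual k H)) :=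
  fun _ _ h ↦ eq_of_forall_apply_eq fun f ↦ congr($h f)

lemma eval_surjective : Function.Surjective (eval k : H → HopfDual k (HopfDual k H)) := fun F ↦ by
  obtain ⟨a, ha⟩ := (Module.evalEquiv k H).surjective
    (toDual k _ F ∘ₗ (toDual k H).symm.toLinearMap)
  exact ⟨a, ext fun f ↦ congr($ha (toDual k H f))⟩

variable (k H) in
/-- The multiplicative map from `H` to its double dual. -/
noncomputable def evalMonoidHom : H →* HopfDual k (HopfDual k H) where
  toFun := eval k
  map_one' := rfl
  map_mul' a b := ext fun f ↦ by
    rw [mul_apply (ℛ k f)]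
    exact (sum_repr (ℛ k f) a b).symm

lemma isGroupLikeElem_eval_iff {a : H} : IsGroupLikeElem k (eval k a) ↔ IsGroupLikeElem k a := by
  constructor
  · intro h
    refine ⟨h.counit_eq_one, eq_of_forall_pairing_eq fun f g ↦ ?_⟩
    rw [pairing_tmul_comul, ← eval_apply, ← pairing_comul, h.comul_eq_tmul_self]
    rfl
  · intro h
    refine ⟨h.counit_eq_one, pairing_ext fun f g ↦ ?_⟩
    rw [pairing_comul]
    exact mul_apply_of_comul_eq h.comul_eq_tmul_self f g

end HopfDual

section Main

variable {k H : Type*} [Field k] [Ring H] [HopfAlgebra k H]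

lemma isGroupLike_iff_isGroupLikeElem {a : H} : IsGroupLike k a ↔ IsGroupLikeElem k a := by
  refine ⟨fun ⟨h0, h⟩ ↦ ⟨?_, h⟩, fun h ↦ ⟨h.ne_zero, h.comul_eq_tmul_self⟩⟩
  have h1 := congr(TensorProduct.lid k H $(rTensor_counit_comul (R := k) a))
  rw [h, LinearMap.rTensor_tmul, TensorProduct.lid_tmul, TensorProduct.lid_tmul] at h1
  exact smul_left_injective k h0 h1

variable [FiniteDimensional k H]

lemma exists_groupLike_apply_ne_one [IsAlgClosed k] [CharZero k] {p q : ℕ} (hp : p.Prime)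
    (hq : q.Prime) (hpq : p < q) (hdim : Module.finrank k H = p * q) {g : H}
    (hg : IsGroupLikeElem k g) (hgp : g ^ p = 1) (hg1 : g ≠ 1) {χ : HopfDual k H}
    (hχ : IsGroupLikeElem k χ) (hχq : χ ^ q = 1) (hχ1 : χ ≠ 1) (hχg : χ g = 1) :
    ∃ l : HopfDual k H, IsGroupLikeElem k l ∧ l g ≠ 1 := by
  let T := HopfDual.twist ⟨χ, hχ⟩
  have hTq : T ^ q = 1 := AlgHom.ext fun a ↦ HopfDual.eq_of_forall_apply_eq fun f ↦ by
    rw [HopfDual.apply_twist_pow, hχq, mul_one]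
    rfl
  have hT1 : T ≠ 1 := fun h ↦ hχ1 <| HopfDual.ext fun a ↦ by
    have h1 := HopfDual.apply_twist ⟨χ, hχ⟩ 1 a
    rw [one_mul] at h1
    rw [← h1]
    exact congr((1 : HopfDual k H) ($h a))
  have hTg : T g = g := HopfDual.eq_of_forall_apply_eq fun f ↦ by
    rw [HopfDual.apply_twist, HopfDual.mul_apply_of_comul_eq hg.comul_eq_tmul_self, hχg, mul_one]
  obtain ⟨l, hl⟩ := exists_algHom_apply_ne_one hp hq hpq hdim hg.comul_eq_tmul_self hgp hg1 hTq hT1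
    (HopfDual.comul_twist _) hTg
  exact ⟨_, (HopfDual.groupLikeEquiv.symm l).2, hl⟩

lemma apply_eq_one_of_pow_eq_one {p q : ℕ} (hpq : p.Coprime q) {g : H} (hg : IsGroupLikeElem k g)
    (hgp : g ^ p = 1) {χ : HopfDual k H} (hχ : IsGroupLikeElem k χ) (hχq : χ ^ q = 1) :
    χ g = 1 := by
  have h1 : χ g ^ p = 1 := by
    have := map_pow (HopfDual.groupLikeEquiv ⟨χ, hχ⟩) g p
    rw [hgp, map_one] at this
    exact this.symm
  have h2 : ∀ m : ℕ, (χ ^ m) g = χ g ^ m := fun m ↦ by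
    induction m with
    | zero => simp [hg.counit_eq_one]
    | succ m ih =>
      rw [pow_succ, HopfDual.mul_apply_of_comul_eq hg.comul_eq_tmul_self, ih, pow_succ]
  have h3 : χ g ^ q = 1 := by rw [← h2, hχq, HopfDual.one_apply, hg.counit_eq_one]
  rw [← pow_one (χ g), ← hpq.gcd_eq_one, pow_gcd_eq_one]
  exact ⟨h1, h3⟩

lemma exists_ne_one_of_card_prime {G : Type*} [Group G] {p : ℕ} (hp : p.Prime)
    (h : Nat.card G = p) : ∃ g : G, g ≠ 1 := by
  have : Finite G := Nat.finite_of_card_ne_zero (h ▸ hp.ne_zero)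
  have : Nontrivial G := Finite.one_lt_card_iff_nontrivial.mp (h ▸ hp.one_lt)
  exact exists_ne 1

end Main

/-- Lemma 5.1. Let `p ≠ q` be primes. There is no Hopf algebra `H` over an
algebraically closed field `k` of characteristic `0` of dimension `p q` such that the set of
group-like elements of `H` has cardinality `p` and the set of group-like elements of `H*`
(equivalently, the `k`-algebra homomorphisms `H → k`) has cardinality `q`. -/
theorem stmt0 (k : Type*) [Field k] [IsAlgClosed k] [CharZero k]
    (p q : ℕ) (hp : p.Prime) (hq : q.Prime) (hpq : p ≠ q)
    (H : Type*) [Ring H] [HopfAlgebra k H] [FiniteDimensional k H] :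
    ¬ (Module.finrank k H = p * q ∧
        Nat.card {a : H // IsGroupLike k a} = p ∧
        Nat.card (H →ₐ[k] k) = q) := by
  rintro ⟨hdim, hcard, hcard'⟩
  have hG : Nat.card (GroupLike k H) = p := by
    rw [← hcard]
    exact Nat.card_congr ((GroupLike.valEquiv).trans
      (Equiv.subtypeEquivRight fun _ ↦ isGroupLike_iff_isGroupLikeElem.symm))
  have hD : Nat.card (GroupLike k (HopfDual k H)) = q := by
    rw [← hcard', Nat.card_congr HopfDual.groupLikeEquiv]
  have hgp : ∀ {g : H}, IsGroupLikeElem k g → g ^ p = 1 := fun {g} hg ↦ by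
    have := pow_card_eq_one' (x := (⟨g, hg⟩ : GroupLike k H))
    rw [hG] at this
    exact congr_arg GroupLike.val this
  have hχq : ∀ {χ : HopfDual k H}, IsGroupLikeElem k χ → χ ^ q = 1 := fun {χ} hχ ↦ by
    have := pow_card_eq_one' (x := (⟨χ, hχ⟩ : GroupLike k (HopfDual k H)))
    rw [hD] at this
    exact congr_arg GroupLike.val this
  have hone : ∀ {g : H} {χ : HopfDual k H}, IsGroupLikeElem k g → IsGroupLikeElem k χ →
      χ g = 1 := fun hg hχ ↦
    apply_eq_one_of_pow_eq_one ((Nat.coprime_primes hp hq).mpr hpq) hg (hgp hg) hχ (hχq hχ)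
  obtain ⟨⟨g, hg⟩, hg1⟩ := exists_ne_one_of_card_prime hp hG
  obtain ⟨⟨χ, hχ⟩, hχ1⟩ := exists_ne_one_of_card_prime hq hD
  replace hg1 : g ≠ 1 := fun h ↦ hg1 (GroupLike.ext h)
  replace hχ1 : χ ≠ 1 := fun h ↦ hχ1 (GroupLike.ext h)
  rcases hpq.lt_or_gt with h | h
  · obtain ⟨l, hl, hlg⟩ := exists_groupLike_apply_ne_one hp hq h hdim hg (hgp hg) hg1 hχ (hχq hχ)
      hχ1 (hone hg hχ)
    exact hlg (hone hg hl)
  · have hdim' : Module.finrank k (HopfDual k H) = q * p := by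
      rw [(HopfDual.toDual k H).finrank_eq, Subspace.dual_finrank_eq, hdim, mul_comm]
    obtain ⟨l, hl, hlχ⟩ := exists_groupLike_apply_ne_one hq hp h hdim' hχ (hχq hχ) hχ1
      (HopfDual.isGroupLikeElem_eval_iff.mpr hg)
      (by
        have := map_pow (HopfDual.evalMonoidHom k H) g p
        rw [hgp hg, map_one] at this
        exact this.symm)
      (fun h ↦ hg1 (HopfDual.eval_injective (k := k) h)) (hone hg hχ)
    obtain ⟨a, rfl⟩ := HopfDual.eval_surjective l
    exact hlχ (hone (HopfDual.isGroupLikeElem_eval_iff.mp hl) hχ)
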